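/- arXiv:2410.04136 — 6 statements merged into one kernel-verified Lean document; each statement's English description precedes it below -/
import Mathlib

section
/- Let c = (c_n)_{n≥1} be a P-admissible sequence with x_0 = val_P(c). For each n ≥ 1 let d^{(n)} be a P-admissible sequence with d^{(n)} ≠ c, and set x_n = val_P(d^{(n)}) and k_n = min{ j ≥ 1 : d^{(n)}_j ≠ c_j }. If k_n → ∞ as n → ∞, then x_n → x_0. -/
open Filter Finset Topology

/-! `φ` encodes the family of functions: `φ []` is `φ₀` and
`φ [c₁, …, cₙ]` is `φₙ(c₁, …, cₙ)`. Sequences are 0-indexed: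
`p 0` is the paper's `p₁`. -/

/-- The list of the first `n` terms of the sequence `p`. -/
def prefixList (p : ℕ → ℕ) (n : ℕ) : List ℕ :=
  List.ofFn (fun i : Fin n => p i)

/-- A sequence `p` is `P`-admissible if `pₙ ≥ r_{n-1} + 1` for all `n ≥ 1`. -/
def PAdmissibleSeq (φ : List ℕ → ℕ) (p : ℕ → ℕ) : Prop :=
  ∀ n : ℕ, φ (prefixList p n) + 1 ≤ p n

/-- A tuple `(c₁, …, c_k)` (given as the first `k` values of `c`) is `P`-admissible. -/
def PAdmissibleTuple (φ : List ℕ → ℕ) (c : ℕ → ℕ) (k : ℕ) : Prop :=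
  ∀ n < k, φ (prefixList c n) + 1 ≤ c n

/-- `r₀ r₁ ⋯ rₙ` where `rᵢ = φᵢ(p₁, …, pᵢ)`. -/
noncomputable def numer (φ : List ℕ → ℕ) (p : ℕ → ℕ) (n : ℕ) : ℝ :=
  ∏ i ∈ Finset.range (n + 1), (φ (prefixList p i) : ℝ)

/-- `(p₁ − 1)p₁ ⋯ (pₙ − 1)pₙ`. -/
noncomputable def denomBase (p : ℕ → ℕ) (n : ℕ) : ℝ :=
  ∏ j ∈ Finset.range n, (((p j : ℝ) - 1) * (p j : ℝ))

/-- The `P`-value `val_P(p) = Σ_{n=0}^∞ (r₀⋯rₙ)/((p₁−1)p₁⋯(pₙ−1)pₙ·p_{n+1})`. -/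
noncomputable def valP (φ : List ℕ → ℕ) (p : ℕ → ℕ) : ℝ :=
  ∑' n : ℕ, numer φ p n / (denomBase p n * (p n : ℝ))

/-- The `P⁻`-value
`val_{P⁻}(q) = Σ_{n=0}^∞ (−1)ⁿ (r₀⋯rₙ)/((q₁−1)q₁⋯(qₙ−1)qₙ·(q_{n+1}−1))`. -/
noncomputable def valPNeg (φ : List ℕ → ℕ) (q : ℕ → ℕ) : ℝ :=
  ∑' n : ℕ, (-1 : ℝ) ^ n * numer φ q n / (denomBase q n * ((q n : ℝ) - 1))

/-- `Inf^P(c₁…c_k) = Σ_{n=0}^{k−1} (r₀⋯rₙ)/((c₁−1)c₁⋯(cₙ−1)cₙ·c_{n+1})`. -/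
noncomputable def InfP (φ : List ℕ → ℕ) (c : ℕ → ℕ) (k : ℕ) : ℝ :=
  ∑ n ∈ Finset.range k, numer φ c n / (denomBase c n * (c n : ℝ))

/-- The diameter `(r₀⋯r_{k−1})/((c₁−1)c₁⋯(c_k−1)c_k)`. -/
noncomputable def DiamP (φ : List ℕ → ℕ) (c : ℕ → ℕ) (k : ℕ) : ℝ :=
  (∏ i ∈ Finset.range k, (φ (prefixList c i) : ℝ)) / denomBase c k

/-- `Sup^P(c₁…c_k) = Inf^P(c₁…c_k) + (r₀⋯r_{k−1})/((c₁−1)c₁⋯(c_k−1)c_k)`. -/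
noncomputable def SupP (φ : List ℕ → ℕ) (c : ℕ → ℕ) (k : ℕ) : ℝ :=
  InfP φ c k + DiamP φ c k

/-- `A(c₁…c_k) = Σ_{n=0}^{k−1} (−1)ⁿ (r₀⋯rₙ)/((c₁−1)c₁⋯(cₙ−1)cₙ·(c_{n+1}−1))`. -/
noncomputable def APNeg (φ : List ℕ → ℕ) (c : ℕ → ℕ) (k : ℕ) : ℝ :=
  ∑ n ∈ Finset.range k, (-1 : ℝ) ^ n * numer φ c n / (denomBase c n * ((c n : ℝ) - 1))

/-- `Sup^{P⁻}(c₁…c_k)`: `A` if `k` odd, `A + D` if `k` even. -/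
noncomputable def SupPNeg (φ : List ℕ → ℕ) (c : ℕ → ℕ) (k : ℕ) : ℝ :=
  if Odd k then APNeg φ c k else APNeg φ c k + DiamP φ c k

/-- `Inf^{P⁻}(c₁…c_k)`: `A − D` if `k` odd, `A` if `k` even. -/
noncomputable def InfPNeg (φ : List ℕ → ℕ) (c : ℕ → ℕ) (k : ℕ) : ℝ :=
  if Odd k then APNeg φ c k - DiamP φ c k else APNeg φ c k

/-- Sequences agreeing below `n` have the same list of first `n` terms. -/
theorem prefixList_congr {p q : ℕ → ℕ} {n : ℕ} (h : ∀ j < n, p j = q j) :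
    prefixList p n = prefixList q n := by
  unfold prefixList
  congr 1
  funext i
  exact h i i.isLt

/-- The `n`-th term of the `P`-value depends only on the first `n + 1` terms of the sequence. -/
theorem valP_term_congr (φ : List ℕ → ℕ) {p q : ℕ → ℕ} {n : ℕ} (h : ∀ j ≤ n, p j = q j) :
    numer φ p n / (denomBase p n * (p n : ℝ)) = numer φ q n / (denomBase q n * (q n : ℝ)) := by
  have hnum : numer φ p n = numer φ q n := by
    refine Finset.prod_congr rfl fun i hi => ?_
    rw [prefixList_congr fun j hj => h j (by have := Finset.mem_range.1 hi; omega)]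
  have hden : denomBase p n = denomBase q n := by
    refine Finset.prod_congr rfl fun j hj => ?_
    rw [h j (Finset.mem_range.1 hj).le]
  rw [hnum, hden, h n le_rfl]

/-- The `n`-th term of the `P`-value of an admissible sequence has absolute value at most
`(1 / 2) ^ n`. -/
theorem norm_valP_term_le {φ : List ℕ → ℕ} (hφ : ∀ l, 0 < φ l) {p : ℕ → ℕ}
    (hp : PAdmissibleSeq φ p) (n : ℕ) :
    ‖numer φ p n / (denomBase p n * (p n : ℝ))‖ ≤ (1 / 2 : ℝ) ^ n := by
  have hr (i : ℕ) : (1 : ℝ) ≤ φ (prefixList p i) := by exact_mod_cast hφ _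
  have hrp (i : ℕ) : (φ (prefixList p i) : ℝ) + 1 ≤ p i := by exact_mod_cast hp i
  have hterm : numer φ p n / (denomBase p n * (p n : ℝ)) =
      (∏ i ∈ Finset.range n, (φ (prefixList p i) : ℝ) / (((p i : ℝ) - 1) * p i)) *
        (φ (prefixList p n) / p n) := by
    rw [numer, denomBase, Finset.prod_range_succ, Finset.prod_div_distrib, mul_div_mul_comm]
  have hfactor (i : ℕ) : 0 ≤ (φ (prefixList p i) : ℝ) / (((p i : ℝ) - 1) * p i) ∧
      (φ (prefixList p i) : ℝ) / (((p i : ℝ) - 1) * p i) ≤ 1 / 2 := by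
    have h1 := hr i
    have h2 := hrp i
    have hpos : 0 < ((p i : ℝ) - 1) * p i := mul_pos (by linarith) (by linarith)
    refine ⟨by positivity, ?_⟩
    rw [div_le_iff₀ hpos]
    nlinarith
  have hlast : (φ (prefixList p n) : ℝ) / p n ≤ 1 :=
    div_le_one_of_le₀ (by linarith [hrp n]) (by positivity)
  have hprod : ∏ i ∈ Finset.range n, (φ (prefixList p i) : ℝ) / (((p i : ℝ) - 1) * p i) ≤
      (1 / 2 : ℝ) ^ n := by
    simpa using Finset.prod_le_prod (s := Finset.range n)
      (fun i _ => (hfactor i).1) (fun i _ => (hfactor i).2)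
  rw [hterm, Real.norm_of_nonneg
    (mul_nonneg (Finset.prod_nonneg fun i _ => (hfactor i).1) (by positivity))]
  calc _ ≤ (1 / 2 : ℝ) ^ n * 1 := mul_le_mul hprod hlast (by positivity) (by positivity)
    _ = _ := mul_one _

/-- if the first index of disagreement `kₙ` tends to infinity,
then `xₙ = val_P(d⁽ⁿ⁾)` tends to `x₀ = val_P(c)`. -/
theorem stmt0 (φ : List ℕ → ℕ) (hφ : ∀ l, 0 < φ l)
    (c : ℕ → ℕ) (hc : PAdmissibleSeq φ c)
    (d : ℕ → (ℕ → ℕ)) (hd : ∀ n, PAdmissibleSeq φ (d n))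
    (hdc : ∀ n, d n ≠ c)
    (k : ℕ → ℕ)
    (hk : ∀ n, d n (k n) ≠ c (k n) ∧ ∀ j < k n, d n j = c j)
    (hkt : Filter.Tendsto k Filter.atTop Filter.atTop) :
    Filter.Tendsto (fun n => valP φ (d n)) Filter.atTop (nhds (valP φ c)) := by
  refine tendsto_tsum_of_dominated_convergence (bound := fun m : ℕ => (1 / 2 : ℝ) ^ m)
    summable_geometric_two (fun m => ?_)
    (Filter.Eventually.of_forall fun n m => norm_valP_term_le hφ (hd n) m)
  refine tendsto_const_nhds.congr' ?_
  filter_upwards [hkt.eventually_gt_atTop m] with n hn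
  exact (valP_term_congr φ fun j hj => (hk n).2 j (hj.trans_lt hn)).symm
end

section
/- Let c = (c_n)_{n≥1} be a P-admissible sequence with x_0 = val_P(c), and assume x_0 is not an endpoint of any P-cylinder, i.e. for every P-admissible finite tuple (b_1,…,b_m) one has x_0 ≠ Inf^P(b_1…b_m) and x_0 ≠ Sup^P(b_1…b_m). For each n ≥ 1 let d^{(n)} be a P-admissible sequence with d^{(n)} ≠ c, and set x_n = val_P(d^{(n)}) and k_n = min{ j ≥ 1 : d^{(n)}_j ≠ c_j }. Then x_n → x_0 if and only if k_n → ∞. -/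
open Filter Finset Topology

theorem prefixList_congr_s1 {c d : ℕ → ℕ} {k j : ℕ} (h : ∀ i < k, d i = c i) (hj : j ≤ k) :
    prefixList d j = prefixList c j := by
  unfold prefixList
  congr 1
  funext i
  exact h i (i.2.trans_le hj)

theorem denomBase_congr {c d : ℕ → ℕ} {k j : ℕ} (h : ∀ i < k, d i = c i) (hj : j ≤ k) :
    denomBase d j = denomBase c j := by
  unfold denomBase
  refine Finset.prod_congr rfl fun i hi => ?_
  rw [h i ((Finset.mem_range.1 hi).trans_le hj)]

theorem InfP_congr (φ : List ℕ → ℕ) {c d : ℕ → ℕ} {k : ℕ} (h : ∀ i < k, d i = c i) :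
    InfP φ d k = InfP φ c k := by
  unfold InfP numer
  refine Finset.sum_congr rfl fun i hi => ?_
  have hi := Finset.mem_range.1 hi
  rw [h i hi, denomBase_congr h hi.le]
  congr 1
  refine Finset.prod_congr rfl fun j hj => ?_
  have hj := Finset.mem_range.1 hj
  rw [prefixList_congr_s1 h (by omega)]

theorem DiamP_congr (φ : List ℕ → ℕ) {c d : ℕ → ℕ} {k : ℕ} (h : ∀ i < k, d i = c i) :
    DiamP φ d k = DiamP φ c k := by
  unfold DiamP
  rw [denomBase_congr h le_rfl]
  congr 1
  refine Finset.prod_congr rfl fun j hj => ?_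
  rw [prefixList_congr_s1 h (Finset.mem_range.1 hj).le]

theorem InfP_succ (φ : List ℕ → ℕ) (c : ℕ → ℕ) (k : ℕ) :
    InfP φ c (k + 1) = InfP φ c k + DiamP φ c k * (φ (prefixList c k) / c k) := by
  rw [InfP, Finset.sum_range_succ, ← InfP, numer, Finset.prod_range_succ, DiamP,
    div_mul_div_comm]

theorem DiamP_succ (φ : List ℕ → ℕ) (c : ℕ → ℕ) (k : ℕ) :
    DiamP φ c (k + 1) =
      DiamP φ c k * (φ (prefixList c k) / (((c k : ℝ) - 1) * c k)) := by
  rw [DiamP, Finset.prod_range_succ, denomBase, Finset.prod_range_succ, DiamP, denomBase,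
    div_mul_div_comm]

theorem PAdmissibleSeq.cast_le {φ : List ℕ → ℕ} {c : ℕ → ℕ} (hc : PAdmissibleSeq φ c) (k : ℕ) :
    (φ (prefixList c k) : ℝ) + 1 ≤ c k := by
  exact_mod_cast hc k

theorem one_le_cast_of_pos {φ : List ℕ → ℕ} (hφ : ∀ l, 0 < φ l) (l : List ℕ) :
    (1 : ℝ) ≤ φ l := by
  exact_mod_cast hφ l

theorem SupP_succ {φ : List ℕ → ℕ} (hφ : ∀ l, 0 < φ l) {c : ℕ → ℕ}
    (hc : PAdmissibleSeq φ c) (k : ℕ) :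
    SupP φ c (k + 1) = InfP φ c k + DiamP φ c k * (φ (prefixList c k) / ((c k : ℝ) - 1)) := by
  have h₁ := one_le_cast_of_pos hφ (prefixList c k)
  have h₂ := hc.cast_le k
  have h₃ : (c k : ℝ) - 1 ≠ 0 := by linarith
  have h₄ : (c k : ℝ) ≠ 0 := by linarith
  rw [SupP, InfP_succ, DiamP_succ]
  field_simp
  ring

theorem DiamP_pos {φ : List ℕ → ℕ} (hφ : ∀ l, 0 < φ l) {c : ℕ → ℕ}
    (hc : PAdmissibleSeq φ c) (k : ℕ) : 0 < DiamP φ c k := by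
  induction k with
  | zero => simp [DiamP, denomBase]
  | succ k ih =>
    have h₁ := one_le_cast_of_pos hφ (prefixList c k)
    have h₂ := hc.cast_le k
    rw [DiamP_succ]
    exact mul_pos ih (div_pos (by linarith) (mul_pos (by linarith) (by linarith)))

theorem DiamP_le_half_pow {φ : List ℕ → ℕ} (hφ : ∀ l, 0 < φ l) {c : ℕ → ℕ}
    (hc : PAdmissibleSeq φ c) (k : ℕ) : DiamP φ c k ≤ (1 / 2) ^ k := by
  induction k with
  | zero => simp [DiamP, denomBase]
  | succ k ih =>
    have h₁ := one_le_cast_of_pos hφ (prefixList c k)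
    have h₂ := hc.cast_le k
    rw [DiamP_succ, pow_succ]
    refine mul_le_mul ih ?_ (div_nonneg (by linarith)
      (mul_nonneg (by linarith) (by linarith))) (by positivity)
    rw [div_le_div_iff₀ (mul_pos (by linarith) (by linarith)) two_pos]
    nlinarith

theorem monotone_InfP {φ : List ℕ → ℕ} (hφ : ∀ l, 0 < φ l) {c : ℕ → ℕ}
    (hc : PAdmissibleSeq φ c) : Monotone (InfP φ c) := by
  refine monotone_nat_of_le_succ fun k => ?_
  rw [InfP_succ]
  have := DiamP_pos hφ hc k
  exact le_add_of_nonneg_right (by positivity)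

theorem antitone_SupP {φ : List ℕ → ℕ} (hφ : ∀ l, 0 < φ l) {c : ℕ → ℕ}
    (hc : PAdmissibleSeq φ c) : Antitone (SupP φ c) := by
  refine antitone_nat_of_succ_le fun k => ?_
  have h₁ := one_le_cast_of_pos hφ (prefixList c k)
  have h₂ := hc.cast_le k
  rw [SupP_succ hφ hc, SupP]
  have h₃ : (φ (prefixList c k) : ℝ) / ((c k : ℝ) - 1) ≤ 1 :=
    (div_le_one (by linarith)).2 (by linarith)
  have := mul_le_of_le_one_right (DiamP_pos hφ hc k).le h₃
  linarith

theorem InfP_le_SupP {φ : List ℕ → ℕ} (hφ : ∀ l, 0 < φ l) {c : ℕ → ℕ}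
    (hc : PAdmissibleSeq φ c) (i k : ℕ) : InfP φ c i ≤ SupP φ c k := by
  have h₁ := monotone_InfP hφ hc (le_max_left i k)
  have h₂ := antitone_SupP hφ hc (le_max_right i k)
  have h₃ := DiamP_pos hφ hc (max i k)
  rw [SupP] at h₂
  linarith

theorem tendsto_InfP {φ : List ℕ → ℕ} (hφ : ∀ l, 0 < φ l) {c : ℕ → ℕ}
    (hc : PAdmissibleSeq φ c) : Tendsto (InfP φ c) atTop (𝓝 (valP φ c)) := by
  have hnonneg : ∀ n, 0 ≤ numer φ c n / (denomBase c n * (c n : ℝ)) := fun n => by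
    have := monotone_InfP hφ hc n.le_succ
    rw [InfP, InfP, Finset.sum_range_succ] at this
    linarith
  exact (summable_of_sum_range_le hnonneg
    fun n => InfP_le_SupP hφ hc n 0).hasSum.tendsto_sum_nat

theorem InfP_le_valP {φ : List ℕ → ℕ} (hφ : ∀ l, 0 < φ l) {c : ℕ → ℕ}
    (hc : PAdmissibleSeq φ c) (k : ℕ) : InfP φ c k ≤ valP φ c :=
  (monotone_InfP hφ hc).ge_of_tendsto (tendsto_InfP hφ hc) k

theorem valP_le_SupP {φ : List ℕ → ℕ} (hφ : ∀ l, 0 < φ l) {c : ℕ → ℕ}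
    (hc : PAdmissibleSeq φ c) (k : ℕ) : valP φ c ≤ SupP φ c k :=
  le_of_tendsto' (tendsto_InfP hφ hc) fun i => InfP_le_SupP hφ hc i k

/-- Two admissible sequences sharing their first `k` terms have values within `2⁻ᵏ`. -/
theorem abs_valP_sub_le {φ : List ℕ → ℕ} (hφ : ∀ l, 0 < φ l) {c d : ℕ → ℕ}
    (hc : PAdmissibleSeq φ c) (hd : PAdmissibleSeq φ d) {k : ℕ} (h : ∀ i < k, d i = c i) :
    |valP φ d - valP φ c| ≤ (1 / 2) ^ k := by
  have h₁ := InfP_le_valP hφ hc k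
  have h₂ := valP_le_SupP hφ hc k
  have h₃ := InfP_le_valP hφ hd k
  have h₄ := valP_le_SupP hφ hd k
  have h₅ := DiamP_le_half_pow hφ hc k
  rw [SupP] at h₂ h₄
  rw [InfP_congr φ h] at h₃ h₄
  rw [DiamP_congr φ h] at h₄
  rw [abs_le]
  constructor <;> linarith

/-- If `d` leaves the cylinder `c₁ … cₘ`, its value is outside the interior of that cylinder. -/
theorem valP_le_InfP_or_SupP_le_valP {φ : List ℕ → ℕ} (hφ : ∀ l, 0 < φ l) {c d : ℕ → ℕ}
    (hc : PAdmissibleSeq φ c) (hd : PAdmissibleSeq φ d) {j m : ℕ} (hjm : j < m)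
    (hne : d j ≠ c j) (h : ∀ i < j, d i = c i) :
    valP φ d ≤ InfP φ c m ∨ SupP φ c m ≤ valP φ d := by
  have hr := one_le_cast_of_pos hφ (prefixList c j)
  have hcj := hc.cast_le j
  have hdj := hd.cast_le j
  have hpre := prefixList_congr_s1 h le_rfl
  rw [hpre] at hdj
  rcases hne.lt_or_gt with hlt | hgt
  · right
    have hlt' : (d j : ℝ) ≤ (c j : ℝ) - 1 := by
      have : (d j : ℝ) + 1 ≤ c j := by exact_mod_cast hlt
      linarith
    calc SupP φ c m ≤ SupP φ c (j + 1) := antitone_SupP hφ hc hjm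
      _ ≤ InfP φ d (j + 1) := by
        rw [SupP_succ hφ hc, InfP_succ, InfP_congr φ h, DiamP_congr φ h, hpre]
        have := DiamP_pos hφ hc j
        have : (0 : ℝ) < d j := by linarith
        gcongr
      _ ≤ valP φ d := InfP_le_valP hφ hd _
  · left
    have hgt' : (c j : ℝ) ≤ (d j : ℝ) - 1 := by
      have : (c j : ℝ) + 1 ≤ d j := by exact_mod_cast hgt
      linarith
    calc valP φ d ≤ SupP φ d (j + 1) := valP_le_SupP hφ hd _
      _ ≤ InfP φ c (j + 1) := by
        rw [SupP_succ hφ hd, InfP_succ, InfP_congr φ h, DiamP_congr φ h, hpre]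
        have := DiamP_pos hφ hc j
        have : (0 : ℝ) < c j := by linarith
        gcongr
      _ ≤ InfP φ c m := monotone_InfP hφ hc hjm

/-- if `x₀ = val_P(c)` is not an endpoint of any `P`-cylinder,
then `xₙ → x₀` iff `kₙ → ∞`. -/
theorem stmt1 (φ : List ℕ → ℕ) (hφ : ∀ l, 0 < φ l)
    (c : ℕ → ℕ) (hc : PAdmissibleSeq φ c)
    (hend : ∀ m : ℕ, 0 < m → ∀ b : ℕ → ℕ, PAdmissibleTuple φ b m →
      valP φ c ≠ InfP φ b m ∧ valP φ c ≠ SupP φ b m)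
    (d : ℕ → (ℕ → ℕ)) (hd : ∀ n, PAdmissibleSeq φ (d n))
    (hdc : ∀ n, d n ≠ c)
    (k : ℕ → ℕ)
    (hk : ∀ n, d n (k n) ≠ c (k n) ∧ ∀ j < k n, d n j = c j) :
    Filter.Tendsto (fun n => valP φ (d n)) Filter.atTop (nhds (valP φ c)) ↔
      Filter.Tendsto k Filter.atTop Filter.atTop := by
  constructor
  · intro hx
    refine tendsto_atTop.2 fun m => ?_
    have hm := hend (m + 1) m.succ_pos c fun n _ => hc n
    have hlo := lt_of_le_of_ne (InfP_le_valP hφ hc (m + 1)) hm.1.symm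
    have hhi := lt_of_le_of_ne (valP_le_SupP hφ hc (m + 1)) hm.2
    filter_upwards [hx.eventually (Ioo_mem_nhds hlo hhi)] with n hn
    by_contra! hlt
    rcases valP_le_InfP_or_SupP_le_valP hφ hc (hd n) (hlt.trans m.lt_succ_self)
      (hk n).1 (hk n).2 with h | h
    · exact h.not_gt hn.1
    · exact h.not_gt hn.2
  · intro hk'
    rw [tendsto_iff_dist_tendsto_zero]
    refine squeeze_zero (fun _ => dist_nonneg) (fun n => ?_)
      ((tendsto_pow_atTop_nhds_zero_of_lt_one (r := (1 / 2 : ℝ)) (by norm_num)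
        (by norm_num)).comp hk')
    rw [Real.dist_eq]
    exact abs_valP_sub_le hφ hc (hd n) (hk n).2
end

section
/- Let c = (c_n)_{n≥1} be a P-admissible sequence with x_0 = val_{P⁻}(c). For each n ≥ 1 let d^{(n)} be a P-admissible sequence with d^{(n)} ≠ c, and set x_n = val_{P⁻}(d^{(n)}) and k_n = min{ j ≥ 1 : d^{(n)}_j ≠ c_j }. Then x_n → x_0 if and only if k_n → ∞. -/
open Filter Finset Topology

/-- The `n`-th summand of `valPNeg φ q`. -/
noncomputable def termPNeg (φ : List ℕ → ℕ) (q : ℕ → ℕ) (n : ℕ) : ℝ :=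
  (-1 : ℝ) ^ n * numer φ q n / (denomBase q n * ((q n : ℝ) - 1))

/-- The ratio `r₀ / ((q₁ − 1) q₁)` relating an expansion to its shift. -/
noncomputable def shiftRatio (φ : List ℕ → ℕ) (q : ℕ → ℕ) : ℝ :=
  (φ [] : ℝ) / (((q 0 : ℝ) - 1) * (q 0 : ℝ))

/-- The family of functions governing the shifted sequence `q₂, q₃, …`. -/
def shiftFamily (φ : List ℕ → ℕ) (a : ℕ) : List ℕ → ℕ := fun l => φ (a :: l)

theorem shiftFamily_pos {φ : List ℕ → ℕ} (hφ : ∀ l, 0 < φ l) (a : ℕ) (l : List ℕ) :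
    0 < shiftFamily φ a l :=
  hφ (a :: l)

/-- The shifted sequence `q₂, q₃, …`. -/
def shiftSeq (q : ℕ → ℕ) : ℕ → ℕ := fun i => q (i + 1)

theorem prefixList_succ (q : ℕ → ℕ) (n : ℕ) :
    prefixList q (n + 1) = q 0 :: prefixList (shiftSeq q) n := by
  simp [prefixList, shiftSeq, List.ofFn_succ]

theorem PAdmissibleSeq.shift {φ : List ℕ → ℕ} {q : ℕ → ℕ} (hq : PAdmissibleSeq φ q) :
    PAdmissibleSeq (shiftFamily φ (q 0)) (shiftSeq q) := fun n => by
  have h := hq (n + 1)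
  rwa [prefixList_succ] at h

theorem PAdmissibleSeq.head_le {φ : List ℕ → ℕ} {q : ℕ → ℕ} (hq : PAdmissibleSeq φ q) :
    (φ [] : ℝ) + 1 ≤ q 0 := by
  have h := hq 0
  simp only [prefixList, List.ofFn_zero] at h
  exact_mod_cast h

theorem numer_succ_shift (φ : List ℕ → ℕ) (q : ℕ → ℕ) (n : ℕ) :
    numer φ q (n + 1) = φ [] * numer (shiftFamily φ (q 0)) (shiftSeq q) n := by
  rw [numer, prod_range_succ', mul_comm]
  simp only [prefixList_succ]
  rfl

theorem denomBase_succ_shift (q : ℕ → ℕ) (n : ℕ) :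
    denomBase q (n + 1) = ((q 0 : ℝ) - 1) * q 0 * denomBase (shiftSeq q) n := by
  rw [denomBase, prod_range_succ', mul_comm]
  simp [denomBase, shiftSeq]

theorem termPNeg_zero (φ : List ℕ → ℕ) (q : ℕ → ℕ) :
    termPNeg φ q 0 = φ [] / ((q 0 : ℝ) - 1) := by
  simp [termPNeg, numer, denomBase, prefixList]

theorem termPNeg_succ (φ : List ℕ → ℕ) (q : ℕ → ℕ) (n : ℕ) :
    termPNeg φ q (n + 1) =
      -shiftRatio φ q * termPNeg (shiftFamily φ (q 0)) (shiftSeq q) n := by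
  rw [termPNeg, numer_succ_shift, denomBase_succ_shift, termPNeg, shiftRatio, pow_succ,
    show (q (n + 1) : ℝ) = shiftSeq q n from rfl]
  simp only [div_eq_mul_inv, mul_inv]
  ring

section Positive

variable {φ : List ℕ → ℕ} {q : ℕ → ℕ}

theorem shiftRatio_pos (hφ : ∀ l, 0 < φ l) (hq : PAdmissibleSeq φ q) :
    0 < shiftRatio φ q := by
  have h := hq.head_le
  have h0 : (1 : ℝ) ≤ φ [] := by exact_mod_cast hφ []
  exact div_pos (by linarith) (mul_pos (by linarith) (by linarith))

theorem shiftRatio_le_half (hφ : ∀ l, 0 < φ l) (hq : PAdmissibleSeq φ q) :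
    shiftRatio φ q ≤ 1 / 2 := by
  have h := hq.head_le
  have h0 : (1 : ℝ) ≤ φ [] := by exact_mod_cast hφ []
  rw [shiftRatio, div_le_iff₀ (mul_pos (by linarith) (by linarith))]
  nlinarith

theorem abs_termPNeg_le (hφ : ∀ l, 0 < φ l) (hq : PAdmissibleSeq φ q) (n : ℕ) :
    |termPNeg φ q n| ≤ (1 / 2) ^ n := by
  induction n generalizing φ q with
  | zero =>
    have h := hq.head_le
    have h0 : (1 : ℝ) ≤ φ [] := by exact_mod_cast hφ []
    rw [termPNeg_zero, abs_of_nonneg (div_nonneg (by linarith) (by linarith)), pow_zero]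
    exact div_le_one_of_le₀ (by linarith) (by linarith)
  | succ n ih =>
    rw [termPNeg_succ, abs_mul, abs_neg, abs_of_pos (shiftRatio_pos hφ hq), pow_succ, mul_comm]
    exact mul_le_mul (ih (shiftFamily_pos hφ _) hq.shift) (shiftRatio_le_half hφ hq)
      (shiftRatio_pos hφ hq).le (by positivity)

theorem summable_termPNeg (hφ : ∀ l, 0 < φ l) (hq : PAdmissibleSeq φ q) :
    Summable (termPNeg φ q) :=
  summable_geometric_two.of_norm_bounded (abs_termPNeg_le hφ hq)

theorem abs_valPNeg_le_two (hφ : ∀ l, 0 < φ l) (hq : PAdmissibleSeq φ q) :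
    |valPNeg φ q| ≤ 2 :=
  tsum_of_norm_bounded (f := termPNeg φ q) hasSum_geometric_two (abs_termPNeg_le hφ hq)

theorem valPNeg_eq_sub_shift (hφ : ∀ l, 0 < φ l) (hq : PAdmissibleSeq φ q) :
    valPNeg φ q = φ [] / ((q 0 : ℝ) - 1) -
      shiftRatio φ q * valPNeg (shiftFamily φ (q 0)) (shiftSeq q) := by
  change ∑' n, termPNeg φ q n = _ - _ * ∑' n, termPNeg _ _ n
  rw [(summable_termPNeg hφ hq).tsum_eq_zero_add, termPNeg_zero]
  simp only [termPNeg_succ, tsum_mul_left]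
  ring

theorem div_sub_one_eq_shiftRatio_mul (hφ : ∀ l, 0 < φ l) (hq : PAdmissibleSeq φ q) :
    (φ [] : ℝ) / ((q 0 : ℝ) - 1) = shiftRatio φ q * q 0 := by
  have h := hq.head_le
  have h0 : (1 : ℝ) ≤ φ [] := by exact_mod_cast hφ []
  have h1 : (q 0 : ℝ) - 1 ≠ 0 := by linarith
  have h2 : (q 0 : ℝ) ≠ 0 := by linarith
  rw [shiftRatio]
  field_simp

theorem div_eq_shiftRatio_mul (hφ : ∀ l, 0 < φ l) (hq : PAdmissibleSeq φ q) :
    (φ [] : ℝ) / q 0 = shiftRatio φ q * ((q 0 : ℝ) - 1) := by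
  have h := hq.head_le
  have h0 : (1 : ℝ) ≤ φ [] := by exact_mod_cast hφ []
  have h1 : (q 0 : ℝ) - 1 ≠ 0 := by linarith
  have h2 : (q 0 : ℝ) ≠ 0 := by linarith
  rw [shiftRatio]
  field_simp

theorem valPNeg_eq_shiftRatio_mul (hφ : ∀ l, 0 < φ l) (hq : PAdmissibleSeq φ q) :
    valPNeg φ q =
      shiftRatio φ q * (q 0 - valPNeg (shiftFamily φ (q 0)) (shiftSeq q)) := by
  rw [valPNeg_eq_sub_shift hφ hq, div_sub_one_eq_shiftRatio_mul hφ hq]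
  ring

theorem valPNeg_nonneg (hφ : ∀ l, 0 < φ l) (hq : PAdmissibleSeq φ q) : 0 ≤ valPNeg φ q := by
  have h := hq.head_le
  have h0 : (1 : ℝ) ≤ φ [] := by exact_mod_cast hφ []
  have h2 := (abs_le.1 (abs_valPNeg_le_two (shiftFamily_pos hφ _) hq.shift)).2
  rw [valPNeg_eq_shiftRatio_mul hφ hq]
  exact mul_nonneg (shiftRatio_pos hφ hq).le (by linarith)

theorem valPNeg_le_one (hφ : ∀ l, 0 < φ l) (hq : PAdmissibleSeq φ q) : valPNeg φ q ≤ 1 := by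
  have h := hq.head_le
  have h0 : (1 : ℝ) ≤ φ [] := by exact_mod_cast hφ []
  have h2 := mul_nonneg (shiftRatio_pos hφ hq).le (valPNeg_nonneg (shiftFamily_pos hφ _) hq.shift)
  have h3 : (φ [] : ℝ) / ((q 0 : ℝ) - 1) ≤ 1 :=
    div_le_one_of_le₀ (by linarith) (by linarith)
  rw [valPNeg_eq_sub_shift hφ hq]
  linarith

theorem valPNeg_pos (hφ : ∀ l, 0 < φ l) (hq : PAdmissibleSeq φ q) : 0 < valPNeg φ q := by
  have h := hq.head_le
  have h0 : (1 : ℝ) ≤ φ [] := by exact_mod_cast hφ []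
  have h2 := valPNeg_le_one (shiftFamily_pos hφ _) hq.shift
  rw [valPNeg_eq_shiftRatio_mul hφ hq]
  exact mul_pos (shiftRatio_pos hφ hq) (by linarith)

theorem valPNeg_lt_div (hφ : ∀ l, 0 < φ l) (hq : PAdmissibleSeq φ q) :
    valPNeg φ q < φ [] / ((q 0 : ℝ) - 1) := by
  rw [valPNeg_eq_sub_shift hφ hq]
  exact sub_lt_self _ (mul_pos (shiftRatio_pos hφ hq) (valPNeg_pos (shiftFamily_pos hφ _) hq.shift))

theorem valPNeg_lt_one (hφ : ∀ l, 0 < φ l) (hq : PAdmissibleSeq φ q) : valPNeg φ q < 1 := by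
  have h := hq.head_le
  exact (valPNeg_lt_div hφ hq).trans_le (div_le_one_of_le₀ (by linarith)
    (by linarith [Nat.cast_nonneg (α := ℝ) (φ [])]))

theorem div_lt_valPNeg (hφ : ∀ l, 0 < φ l) (hq : PAdmissibleSeq φ q) :
    (φ [] : ℝ) / q 0 < valPNeg φ q := by
  rw [valPNeg_eq_shiftRatio_mul hφ hq, div_eq_shiftRatio_mul hφ hq]
  exact mul_lt_mul_of_pos_left (by linarith [valPNeg_lt_one (shiftFamily_pos hφ _) hq.shift])
    (shiftRatio_pos hφ hq)

end Positive

theorem head_le_of_mem {φ : List ℕ → ℕ} {q : ℕ → ℕ} (hφ : ∀ l, 0 < φ l)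
    (hq : PAdmissibleSeq φ q) {m : ℕ} (hm : 0 < m) (h : (φ [] : ℝ) / m < valPNeg φ q) :
    q 0 ≤ m := by
  by_contra! hlt
  have h1 : (m : ℝ) ≤ q 0 - 1 := by
    have : (m : ℝ) + 1 ≤ q 0 := by exact_mod_cast hlt
    linarith
  have h2 : (φ [] : ℝ) / (q 0 - 1) ≤ φ [] / m :=
    div_le_div_of_nonneg_left (Nat.cast_nonneg _) (by exact_mod_cast hm) h1
  linarith [valPNeg_lt_div hφ hq]

theorem head_ge_of_mem {φ : List ℕ → ℕ} {q : ℕ → ℕ} (hφ : ∀ l, 0 < φ l)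
    (hq : PAdmissibleSeq φ q) {m : ℕ} (h : valPNeg φ q < (φ [] : ℝ) / (m - 1)) :
    m ≤ q 0 := by
  by_contra! hlt
  have h0 : (1 : ℝ) ≤ φ [] := by exact_mod_cast hφ []
  have h1 : (q 0 : ℝ) ≤ m - 1 := by
    have : (q 0 : ℝ) + 1 ≤ m := by exact_mod_cast hlt
    linarith
  have h2 : (φ [] : ℝ) / (m - 1) ≤ φ [] / q 0 :=
    div_le_div_of_nonneg_left (Nat.cast_nonneg _) (by linarith [hq.head_le]) h1
  linarith [div_lt_valPNeg hφ hq]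

theorem valPNeg_sub_valPNeg_of_head_eq {φ : List ℕ → ℕ} {c d : ℕ → ℕ} (hφ : ∀ l, 0 < φ l)
    (hc : PAdmissibleSeq φ c) (hd : PAdmissibleSeq φ d) (h : d 0 = c 0) :
    valPNeg φ d - valPNeg φ c =
      -shiftRatio φ c * (valPNeg (shiftFamily φ (c 0)) (shiftSeq d) -
        valPNeg (shiftFamily φ (c 0)) (shiftSeq c)) := by
  rw [valPNeg_eq_sub_shift hφ hc, valPNeg_eq_sub_shift hφ hd, shiftRatio, shiftRatio, h]
  ring

theorem abs_valPNeg_sub_le {φ : List ℕ → ℕ} {c d : ℕ → ℕ} (hφ : ∀ l, 0 < φ l)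
    (hc : PAdmissibleSeq φ c) (hd : PAdmissibleSeq φ d) {k : ℕ} (h : ∀ j < k, d j = c j) :
    |valPNeg φ d - valPNeg φ c| ≤ (1 / 2) ^ k := by
  induction k generalizing φ c d with
  | zero =>
    rw [pow_zero, abs_le]
    constructor <;> linarith [valPNeg_pos hφ hc, valPNeg_pos hφ hd, valPNeg_lt_one hφ hc,
      valPNeg_lt_one hφ hd]
  | succ k ih =>
    have h0 : d 0 = c 0 := h 0 k.succ_pos
    rw [valPNeg_sub_valPNeg_of_head_eq hφ hc hd h0, abs_mul, abs_neg,
      abs_of_pos (shiftRatio_pos hφ hc), pow_succ, mul_comm]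
    exact mul_le_mul (ih (shiftFamily_pos hφ _) hc.shift (h0 ▸ hd.shift)
      fun j hj => h (j + 1) (by omega)) (shiftRatio_le_half hφ hc)
      (shiftRatio_pos hφ hc).le (by positivity)

theorem exists_pos_forall_abs_sub_lt_agree {φ : List ℕ → ℕ} {c : ℕ → ℕ} (hφ : ∀ l, 0 < φ l)
    (hc : PAdmissibleSeq φ c) (k : ℕ) :
    ∃ ε > 0, ∀ d, PAdmissibleSeq φ d → |valPNeg φ d - valPNeg φ c| < ε →
      ∀ j < k, d j = c j := by
  induction k generalizing φ c with
  | zero => exact ⟨1, one_pos, fun _ _ _ j hj => absurd hj j.not_lt_zero⟩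
  | succ k ih =>
    obtain ⟨ε, hε, H⟩ := ih (shiftFamily_pos hφ (c 0)) hc.shift
    have hs := shiftRatio_pos hφ hc
    refine ⟨min (shiftRatio φ c * ε) (min (valPNeg φ c - φ [] / c 0)
      (φ [] / ((c 0 : ℝ) - 1) - valPNeg φ c)), lt_min (mul_pos hs hε)
      (lt_min (sub_pos.2 (div_lt_valPNeg hφ hc)) (sub_pos.2 (valPNeg_lt_div hφ hc))), ?_⟩
    intro d hd hlt
    obtain ⟨h1, h2, h3⟩ : _ ∧ _ ∧ _ := by simpa only [lt_min_iff] using hlt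
    have hc0 : 0 < c 0 := (Nat.succ_pos _).trans_le (hc 0)
    have h0 : d 0 = c 0 := le_antisymm
      (head_le_of_mem hφ hd hc0 (by linarith [(abs_lt.1 h2).1]))
      (head_ge_of_mem hφ hd (by linarith [(abs_lt.1 h3).2]))
    rw [valPNeg_sub_valPNeg_of_head_eq hφ hc hd h0, abs_mul, abs_neg, abs_of_pos hs] at h1
    rintro (_ | j) hj
    · exact h0
    · exact H _ (h0 ▸ hd.shift) (lt_of_mul_lt_mul_left h1 hs.le) j (by omega)

/-- for the alternating expansion, `xₙ → x₀` iff `kₙ → ∞`. -/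
theorem stmt5 (φ : List ℕ → ℕ) (hφ : ∀ l, 0 < φ l)
    (c : ℕ → ℕ) (hc : PAdmissibleSeq φ c)
    (d : ℕ → (ℕ → ℕ)) (hd : ∀ n, PAdmissibleSeq φ (d n))
    (hdc : ∀ n, d n ≠ c)
    (k : ℕ → ℕ)
    (hk : ∀ n, d n (k n) ≠ c (k n) ∧ ∀ j < k n, d n j = c j) :
    Filter.Tendsto (fun n => valPNeg φ (d n)) Filter.atTop (nhds (valPNeg φ c)) ↔
      Filter.Tendsto k Filter.atTop Filter.atTop := by
  constructor
  · intro h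
    rw [tendsto_atTop]
    intro K
    obtain ⟨ε, hε, H⟩ := exists_pos_forall_abs_sub_lt_agree hφ hc K
    filter_upwards [Metric.tendsto_nhds.1 h ε hε] with n hn
    by_contra! hlt
    exact (hk n).1 (H (d n) (hd n) hn _ hlt)
  · intro h
    rw [tendsto_iff_norm_sub_tendsto_zero]
    exact squeeze_zero (fun _ => norm_nonneg _)
      (fun n => abs_valPNeg_sub_le hφ hc (hd n) (hk n).2)
      ((tendsto_pow_atTop_nhds_zero_of_lt_one (by norm_num) (by norm_num)).comp h)
end

section
/- For each n ≥ 1 let d^{(n)} be a P-admissible sequence and set x_n = val_{P⁻}(d^{(n)}). Then x_n → 0 as n → ∞ if and only if d^{(n)}_1 → ∞ as n → ∞. -/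
open Filter Finset Topology

/-- The absolute value of the `n`-th term of the alternating series `val_{P⁻}(q)`. -/
noncomputable def absTermPNeg (φ : List ℕ → ℕ) (q : ℕ → ℕ) (n : ℕ) : ℝ :=
  numer φ q n / (denomBase q n * ((q n : ℝ) - 1))

namespace PAdmissibleSeq

variable {φ : List ℕ → ℕ} {q : ℕ → ℕ}

theorem cast_le_sub_one (hq : PAdmissibleSeq φ q) (n : ℕ) :
    (φ (prefixList q n) : ℝ) ≤ (q n : ℝ) - 1 := by
  have h : ((φ (prefixList q n) + 1 : ℕ) : ℝ) ≤ q n := by exact_mod_cast hq n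
  push_cast at h
  linarith

theorem two_le (hφ : ∀ l, 0 < φ l) (hq : PAdmissibleSeq φ q) (n : ℕ) : (2 : ℝ) ≤ q n := by
  have h₁ := hφ (prefixList q n)
  have h₂ := hq n
  have h : 2 ≤ q n := by omega
  exact_mod_cast h

theorem denomBase_pos (hφ : ∀ l, 0 < φ l) (hq : PAdmissibleSeq φ q) (n : ℕ) :
    0 < denomBase q n := by
  refine Finset.prod_pos fun j _ => ?_
  have := hq.two_le hφ j
  exact mul_pos (by linarith) (by linarith)

theorem absTermPNeg_nonneg (hφ : ∀ l, 0 < φ l) (hq : PAdmissibleSeq φ q) (n : ℕ) :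
    0 ≤ absTermPNeg φ q n := by
  have := hq.two_le hφ n
  exact div_nonneg (Finset.prod_nonneg fun _ _ => Nat.cast_nonneg _)
    (mul_nonneg (hq.denomBase_pos hφ n).le (by linarith))

theorem absTermPNeg_succ_le (hφ : ∀ l, 0 < φ l) (hq : PAdmissibleSeq φ q) (n : ℕ) :
    absTermPNeg φ q (n + 1) ≤ absTermPNeg φ q n / q n := by
  have h₁ := hq.two_le hφ n
  have h₂ := hq.two_le hφ (n + 1)
  have hD := hq.denomBase_pos hφ n
  have hr : (φ (prefixList q (n + 1)) : ℝ) / ((q (n + 1) : ℝ) - 1) ≤ 1 :=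
    (div_le_one (by linarith)).2 (hq.cast_le_sub_one (n + 1))
  have hq₀ : (q n : ℝ) ≠ 0 := by linarith
  have hq₁ : (q n : ℝ) - 1 ≠ 0 := by linarith
  have hq₂ : (q (n + 1) : ℝ) - 1 ≠ 0 := by linarith
  have h : absTermPNeg φ q (n + 1) = absTermPNeg φ q n / q n *
      ((φ (prefixList q (n + 1)) : ℝ) / ((q (n + 1) : ℝ) - 1)) := by
    have hN : numer φ q (n + 1) = numer φ q n * φ (prefixList q (n + 1)) :=
      Finset.prod_range_succ _ _
    have hB : denomBase q (n + 1) = denomBase q n * (((q n : ℝ) - 1) * q n) :=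
      Finset.prod_range_succ _ _
    rw [absTermPNeg, absTermPNeg, hN, hB]
    field_simp
  rw [h]
  exact mul_le_of_le_one_right
    (div_nonneg (hq.absTermPNeg_nonneg hφ n) (by linarith)) hr

theorem absTermPNeg_succ_le_half (hφ : ∀ l, 0 < φ l) (hq : PAdmissibleSeq φ q) (n : ℕ) :
    absTermPNeg φ q (n + 1) ≤ 1 / 2 * absTermPNeg φ q n := by
  refine (hq.absTermPNeg_succ_le hφ n).trans ?_
  rw [one_div_mul_eq_div]
  exact div_le_div_of_nonneg_left (hq.absTermPNeg_nonneg hφ n) two_pos (hq.two_le hφ n)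

theorem antitone_absTermPNeg (hφ : ∀ l, 0 < φ l) (hq : PAdmissibleSeq φ q) :
    Antitone (absTermPNeg φ q) := by
  refine antitone_nat_of_succ_le fun n => ?_
  have h₁ := hq.absTermPNeg_succ_le_half hφ n
  have h₂ := hq.absTermPNeg_nonneg hφ n
  linarith

theorem tendsto_sum_valPNeg (hφ : ∀ l, 0 < φ l) (hq : PAdmissibleSeq φ q) :
    Tendsto (fun n => ∑ i ∈ Finset.range n, (-1 : ℝ) ^ i * absTermPNeg φ q i) atTop
      (𝓝 (valPNeg φ q)) := by
  have hs : Summable fun n => (-1 : ℝ) ^ n * absTermPNeg φ q n := by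
    refine summable_of_ratio_norm_eventually_le (r := 1 / 2) (by norm_num)
      (Eventually.of_forall fun n => ?_)
    simpa [abs_mul, abs_of_nonneg (hq.absTermPNeg_nonneg hφ _)] using
      hq.absTermPNeg_succ_le_half hφ n
  have hv : valPNeg φ q = ∑' n, (-1 : ℝ) ^ n * absTermPNeg φ q n :=
    tsum_congr fun n => mul_div_assoc _ _ _
  rw [hv]
  exact hs.hasSum.tendsto_sum_nat

theorem absTermPNeg_zero : absTermPNeg φ q 0 = (φ [] : ℝ) / ((q 0 : ℝ) - 1) := by
  simp [absTermPNeg, numer, denomBase, prefixList]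

theorem valPNeg_le (hφ : ∀ l, 0 < φ l) (hq : PAdmissibleSeq φ q) :
    valPNeg φ q ≤ (φ [] : ℝ) / ((q 0 : ℝ) - 1) := by
  have h := (hq.antitone_absTermPNeg hφ).tendsto_le_alternating_series
    (hq.tendsto_sum_valPNeg hφ) 0
  simpa [absTermPNeg_zero] using h

theorem le_valPNeg (hφ : ∀ l, 0 < φ l) (hq : PAdmissibleSeq φ q) :
    (φ [] : ℝ) / q 0 ≤ valPNeg φ q := by
  have h := (hq.antitone_absTermPNeg hφ).alternating_series_le_tendsto
    (hq.tendsto_sum_valPNeg hφ) 1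
  have h₀ := hq.two_le hφ 0
  have h₁ := hq.absTermPNeg_succ_le hφ 0
  have hq₀ : (q 0 : ℝ) ≠ 0 := by linarith
  have hq₁ : (q 0 : ℝ) - 1 ≠ 0 := by linarith
  have he : (φ [] : ℝ) / q 0 = absTermPNeg φ q 0 - absTermPNeg φ q 0 / q 0 := by
    rw [absTermPNeg_zero]
    field_simp
  simp only [mul_one, Finset.sum_range_succ, Finset.sum_range_zero, pow_zero, pow_one] at h
  rw [zero_add] at h₁
  linarith

end PAdmissibleSeq

/-- `xₙ = val_{P⁻}(d⁽ⁿ⁾) → 0` iff the first digits `d⁽ⁿ⁾₁ → ∞`. -/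
theorem stmt6 (φ : List ℕ → ℕ) (hφ : ∀ l, 0 < φ l)
    (d : ℕ → (ℕ → ℕ)) (hd : ∀ n, PAdmissibleSeq φ (d n)) :
    Filter.Tendsto (fun n => valPNeg φ (d n)) Filter.atTop (nhds 0) ↔
      Filter.Tendsto (fun n => d n 0) Filter.atTop Filter.atTop := by
  constructor
  · intro h
    rw [← tendsto_natCast_atTop_iff (R := ℝ)]
    have hpos : ∀ n, (0 : ℝ) < d n 0 := fun n => by linarith [(hd n).two_le hφ 0]
    have hle : ∀ n, (d n 0 : ℝ)⁻¹ ≤ valPNeg φ (d n) := fun n => by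
      refine le_trans ?_ ((hd n).le_valPNeg hφ)
      rw [inv_eq_one_div]
      exact div_le_div_of_nonneg_right (by exact_mod_cast hφ []) (hpos n).le
    have h₀ := squeeze_zero (fun n => (inv_pos.2 (hpos n)).le) hle h
    have h₁ : Tendsto (fun n => (d n 0 : ℝ)⁻¹) atTop (𝓝[>] 0) :=
      tendsto_nhdsWithin_iff.2 ⟨h₀, Eventually.of_forall fun n => inv_pos.2 (hpos n)⟩
    exact h₁.inv_tendsto_nhdsGT_zero.congr fun n => inv_inv _
  · intro h
    refine squeeze_zero (fun n => ?_) (fun n => (hd n).valPNeg_le hφ) ?_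
    · exact le_trans (div_nonneg (Nat.cast_nonneg _) (Nat.cast_nonneg _))
        ((hd n).le_valPNeg hφ)
    · exact (tendsto_atTop_add_const_right atTop (-1)
        (tendsto_natCast_atTop_iff.2 h)).const_div_atTop _
end

section
/- For every P-admissible sequence p = (p_n)_{n≥1}, with r_0 = φ_0, one has r_0/p_1 < val_P(p) ≤ r_0/(p_1 − 1). -/
open Filter Finset Topology

/-- Each `pₙ` of an admissible sequence exceeds `1`, being at least `r_{n-1} + 1`. -/
lemma PAdmissibleSeq.one_lt {φ : List ℕ → ℕ} (hφ : ∀ l, 0 < φ l) {p : ℕ → ℕ}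
    (hp : PAdmissibleSeq φ p) (n : ℕ) : (1 : ℝ) < p n := by
  have h₁ := hp n
  have h₂ := hφ (prefixList p n)
  exact_mod_cast (show 1 < p n by omega)

lemma numer_pos {φ : List ℕ → ℕ} (hφ : ∀ l, 0 < φ l) (p : ℕ → ℕ) (n : ℕ) :
    0 < numer φ p n :=
  Finset.prod_pos fun _ _ => Nat.cast_pos.mpr (hφ _)

lemma denomBase_pos {p : ℕ → ℕ} (hp : ∀ n, (1 : ℝ) < p n) (n : ℕ) : 0 < denomBase p n :=
  Finset.prod_pos fun j _ => mul_pos (sub_pos.mpr (hp j)) (zero_lt_one.trans (hp j))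

/-- The bound `r₀⋯rₙ / ((p₁−1)p₁⋯(pₙ−1)pₙ·(p_{n+1}−1))` on the tail of the series dominates
the `n`-th term plus the bound on the next tail. -/
lemma term_add_tail_bound_le {φ : List ℕ → ℕ} (hφ : ∀ l, 0 < φ l) {p : ℕ → ℕ}
    (hp : PAdmissibleSeq φ p) (n : ℕ) :
    numer φ p n / (denomBase p n * (p n : ℝ)) +
        numer φ p (n + 1) / (denomBase p (n + 1) * ((p (n + 1) : ℝ) - 1)) ≤
      numer φ p n / (denomBase p n * ((p n : ℝ) - 1)) := by
  have hD := denomBase_pos (hp.one_lt hφ) n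
  have hD' := denomBase_pos (hp.one_lt hφ) (n + 1)
  have h₀ : 0 < (p n : ℝ) - 1 := sub_pos.mpr (hp.one_lt hφ n)
  have h₁ : 0 < (p (n + 1) : ℝ) - 1 := sub_pos.mpr (hp.one_lt hφ (n + 1))
  have hpn : 0 < (p n : ℝ) := zero_lt_one.trans (hp.one_lt hφ n)
  have hr : (φ (prefixList p (n + 1)) : ℝ) ≤ (p (n + 1) : ℝ) - 1 := by
    have : (φ (prefixList p (n + 1)) : ℝ) + 1 ≤ p (n + 1) := by exact_mod_cast hp (n + 1)
    linarith
  have hN : numer φ p (n + 1) = numer φ p n * φ (prefixList p (n + 1)) :=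
    Finset.prod_range_succ _ _
  have hB : denomBase p (n + 1) = denomBase p n * (((p n : ℝ) - 1) * p n) :=
    Finset.prod_range_succ _ _
  have htail : numer φ p (n + 1) / (denomBase p (n + 1) * ((p (n + 1) : ℝ) - 1)) ≤
      numer φ p n / denomBase p (n + 1) := by
    rw [hN, div_le_div_iff₀ (mul_pos hD' h₁) hD']
    have := mul_le_mul_of_nonneg_left hr (mul_pos (numer_pos hφ p n) hD').le
    linarith
  have hsplit : numer φ p n / (denomBase p n * (p n : ℝ)) + numer φ p n / denomBase p (n + 1) =
      numer φ p n / (denomBase p n * ((p n : ℝ) - 1)) := by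
    rw [hB]
    field_simp
    ring
  linarith

lemma sum_range_add_tail_bound_le {φ : List ℕ → ℕ} (hφ : ∀ l, 0 < φ l) {p : ℕ → ℕ}
    (hp : PAdmissibleSeq φ p) (n : ℕ) :
    ∑ i ∈ Finset.range n, numer φ p i / (denomBase p i * (p i : ℝ)) +
        numer φ p n / (denomBase p n * ((p n : ℝ) - 1)) ≤
      (φ [] : ℝ) / ((p 0 : ℝ) - 1) := by
  induction n with
  | zero => simp [numer, denomBase, prefixList]
  | succ n ih =>
    rw [Finset.sum_range_succ]
    linarith [term_add_tail_bound_le hφ hp n]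

/-- `r₀/p₁ < val_P(p) ≤ r₀/(p₁ − 1)`. -/
theorem stmt9 (φ : List ℕ → ℕ) (hφ : ∀ l, 0 < φ l)
    (p : ℕ → ℕ) (hp : PAdmissibleSeq φ p) :
    (φ [] : ℝ) / (p 0 : ℝ) < valP φ p ∧
      valP φ p ≤ (φ [] : ℝ) / ((p 0 : ℝ) - 1) := by
  have hpos : ∀ n, 0 < numer φ p n / (denomBase p n * (p n : ℝ)) := fun n =>
    div_pos (numer_pos hφ p n)
      (mul_pos (denomBase_pos (hp.one_lt hφ) n) (zero_lt_one.trans (hp.one_lt hφ n)))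
  have hle : ∀ n, ∑ i ∈ Finset.range n, numer φ p i / (denomBase p i * (p i : ℝ)) ≤
      (φ [] : ℝ) / ((p 0 : ℝ) - 1) := fun n => by
    have htail : 0 ≤ numer φ p n / (denomBase p n * ((p n : ℝ) - 1)) :=
      (div_pos (numer_pos hφ p n) (mul_pos (denomBase_pos (hp.one_lt hφ) n)
        (sub_pos.mpr (hp.one_lt hφ n)))).le
    linarith [sum_range_add_tail_bound_le hφ hp n]
  have hsum := summable_of_sum_range_le (fun n => (hpos n).le) hle
  refine ⟨?_, Real.tsum_le_of_sum_range_le (fun n => (hpos n).le) hle⟩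
  have hfirst : numer φ p 0 / (denomBase p 0 * (p 0 : ℝ)) = (φ [] : ℝ) / (p 0 : ℝ) := by
    simp [numer, denomBase, prefixList]
  have htwo := hsum.sum_le_tsum (Finset.range 2) fun n _ => (hpos n).le
  rw [Finset.sum_range_succ, Finset.sum_range_one, hfirst] at htwo
  exact (lt_add_of_pos_right _ (hpos 1)).trans_le htwo
end

section
/- For every P-admissible sequence q = (q_n)_{n≥1}, with r_0 = φ_0, one has r_0/q_1 < val_{P⁻}(q) < r_0/(q_1 − 1). -/
open Filter Finset Topology

/-- An alternating series of positive terms decreasing at least by a factor `2` is strictly between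
its second and its first partial sum. -/
theorem alternating_tsum_bounds {a : ℕ → ℝ} (ha : ∀ n, 0 < a n)
    (h : ∀ n, a (n + 1) ≤ a n / 2) :
    a 0 - a 1 < ∑' n, (-1 : ℝ) ^ n * a n ∧ ∑' n, (-1 : ℝ) ^ n * a n < a 0 := by
  have hlt : ∀ n, a (n + 1) < a n := fun n => (h n).trans_lt (half_lt_self (ha n))
  have hsum : Summable fun n => (-1 : ℝ) ^ n * a n := by
    refine summable_of_ratio_norm_eventually_le (r := 1 / 2) (by norm_num)
      (Eventually.of_forall fun n => ?_)
    simp only [norm_mul, norm_pow, norm_neg, norm_one, one_pow, one_mul, Real.norm_eq_abs,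
      abs_of_pos (ha _)]
    linarith [h n]
  have htend := hsum.hasSum.tendsto_sum_nat
  have hanti : Antitone a := antitone_nat_of_succ_le fun n => (hlt n).le
  have hlower := hanti.alternating_series_le_tendsto htend 2
  have hupper := hanti.tendsto_le_alternating_series htend 1
  norm_num [Finset.sum_range_succ] at hlower hupper
  constructor
  · linarith [hlt 2]
  · linarith [hlt 1]

theorem PAdmissibleSeq.le_sub_one {φ : List ℕ → ℕ} {q : ℕ → ℕ} (hq : PAdmissibleSeq φ q)
    (n : ℕ) : (φ (prefixList q n) : ℝ) ≤ (q n : ℝ) - 1 := by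
  have h : (φ (prefixList q n) : ℝ) + 1 ≤ q n := mod_cast hq n
  linarith

theorem PAdmissibleSeq.two_le_s10 {φ : List ℕ → ℕ} (hφ : ∀ l, 0 < φ l) {q : ℕ → ℕ}
    (hq : PAdmissibleSeq φ q) (n : ℕ) : (2 : ℝ) ≤ q n := by
  have h : 2 ≤ q n := (Nat.succ_le_succ (hφ (prefixList q n))).trans (hq n)
  exact_mod_cast h

theorem PAdmissibleSeq.term_pos {φ : List ℕ → ℕ} (hφ : ∀ l, 0 < φ l) {q : ℕ → ℕ}
    (hq : PAdmissibleSeq φ q) (n : ℕ) :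
    0 < numer φ q n / (denomBase q n * ((q n : ℝ) - 1)) := by
  have hq2 := hq.two_le_s10 hφ
  have hnumer : 0 < numer φ q n := Finset.prod_pos fun i _ => Nat.cast_pos.mpr (hφ _)
  have hdenom : 0 < denomBase q n :=
    Finset.prod_pos fun j _ => mul_pos (by linarith [hq2 j]) (by linarith [hq2 j])
  exact div_pos hnumer (mul_pos hdenom (by linarith [hq2 n]))

theorem PAdmissibleSeq.term_succ_le {φ : List ℕ → ℕ} (hφ : ∀ l, 0 < φ l) {q : ℕ → ℕ}
    (hq : PAdmissibleSeq φ q) (n : ℕ) :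
    numer φ q (n + 1) / (denomBase q (n + 1) * ((q (n + 1) : ℝ) - 1)) ≤
      numer φ q n / (denomBase q n * ((q n : ℝ) - 1)) / q n := by
  have hq2 := hq.two_le_s10 hφ
  have hnum : numer φ q (n + 1) = numer φ q n * φ (prefixList q (n + 1)) :=
    Finset.prod_range_succ _ _
  have hden : denomBase q (n + 1) = denomBase q n * (((q n : ℝ) - 1) * q n) :=
    Finset.prod_range_succ _ _
  have hterm : numer φ q (n + 1) / (denomBase q (n + 1) * ((q (n + 1) : ℝ) - 1)) =
      numer φ q n / (denomBase q n * ((q n : ℝ) - 1)) / q n *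
        (φ (prefixList q (n + 1)) / ((q (n + 1) : ℝ) - 1)) := by
    rw [hnum, hden, div_div, div_mul_div_comm]
    simp only [mul_assoc]
  rw [hterm]
  refine mul_le_of_le_one_right (div_nonneg (hq.term_pos hφ n).le (Nat.cast_nonneg _)) ?_
  exact div_le_one_of_le₀ (hq.le_sub_one (n + 1)) (by linarith [hq2 (n + 1)])

/-- `r₀/q₁ < val_{P⁻}(q) < r₀/(q₁ − 1)`. -/
theorem stmt10 (φ : List ℕ → ℕ) (hφ : ∀ l, 0 < φ l)
    (q : ℕ → ℕ) (hq : PAdmissibleSeq φ q) :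
    (φ [] : ℝ) / (q 0 : ℝ) < valPNeg φ q ∧
      valPNeg φ q < (φ [] : ℝ) / ((q 0 : ℝ) - 1) := by
  have hq2 := hq.two_le_s10 hφ
  have hratio := hq.term_succ_le hφ
  have hbounds := alternating_tsum_bounds (hq.term_pos hφ) fun n =>
    (hratio n).trans (div_le_div_of_nonneg_left (hq.term_pos hφ n).le two_pos (hq2 n))
  have hzero : numer φ q 0 / (denomBase q 0 * ((q 0 : ℝ) - 1)) = φ [] / ((q 0 : ℝ) - 1) := by
    simp [numer, denomBase, prefixList]
  have hval : valPNeg φ q =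
      ∑' n, (-1 : ℝ) ^ n * (numer φ q n / (denomBase q n * ((q n : ℝ) - 1))) :=
    tsum_congr fun n => mul_div_assoc _ _ _
  have hone := hratio 0
  rw [zero_add, hzero] at hone
  rw [hzero, ← hval] at hbounds
  have hsplit : (φ [] : ℝ) / ((q 0 : ℝ) - 1) - φ [] / ((q 0 : ℝ) - 1) / q 0 = φ [] / q 0 := by
    have h0 : (q 0 : ℝ) ≠ 0 := by linarith [hq2 0]
    have h1 : (q 0 : ℝ) - 1 ≠ 0 := by linarith [hq2 0]
    field_simp
  exact ⟨by linarith [hbounds.1], hbounds.2⟩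
end
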